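/- arXiv:2208.13637 — 6 statements merged into one kernel-verified Lean document; each statement's English description precedes it below -/
import Mathlib

section
/- Let G be a generalized (m,n)-ladder graph and let e, e' ∈ [G₁,G₂] be edges both satisfying L↑(e) ∩ R↓(e) = ∅ and L↑(e') ∩ R↓(e') = ∅. Then either (l(e) ≤ l(e') and r(e) ≤ r(e')) or (l(e') ≤ l(e) and r(e') ≤ r(e)). -/
open SimpleGraph

/-- `G` contains a subdivision of `H`: there is an injection `f` of the vertices of `H`
into the vertices of `G` and, for each edge of `H`, a path in `G` between the images of its
endpoints, such that the paths pass through no branch vertices other than their own endpoints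
and paths corresponding to distinct edges are internally disjoint. -/
def ContainsSubdivision {V W : Type*} (G : SimpleGraph V) (H : SimpleGraph W) : Prop :=
  ∃ f : W → V, Function.Injective f ∧
    ∃ p : ∀ ⦃a b : W⦄, H.Adj a b → G.Walk (f a) (f b),
      (∀ ⦃a b : W⦄ (h : H.Adj a b), (p h).IsPath) ∧
      (∀ ⦃a b : W⦄ (h : H.Adj a b) (w : W), f w ∈ (p h).support → w = a ∨ w = b) ∧
      (∀ ⦃a b a' b' : W⦄ (h : H.Adj a b) (h' : H.Adj a' b'), s(a, b) ≠ s(a', b') →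
        ∀ v, v ∈ (p h).support → v ∈ (p h').support →
          (v = f a ∨ v = f b) ∧ (v = f a' ∨ v = f b'))

/-- A graph is planar iff it contains no subdivision of `K₅` or `K₃,₃` (Kuratowski). -/
def IsPlanar {V : Type*} (G : SimpleGraph V) : Prop :=
  ¬ ContainsSubdivision G (completeGraph (Fin 5)) ∧
  ¬ ContainsSubdivision G (completeBipartiteGraph (Fin 3) (Fin 3))

/-- A graph is outerplanar iff it contains no subdivision of `K₄` or `K₃,₂`
(Chartrand–Harary). -/
def IsOuterplanar {V : Type*} (G : SimpleGraph V) : Prop :=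
  ¬ ContainsSubdivision G (completeGraph (Fin 4)) ∧
  ¬ ContainsSubdivision G (completeBipartiteGraph (Fin 3) (Fin 2))

/-- The base relation of a generalized (m,n)-ladder graph: consecutive vertices on each of the
two paths are adjacent, and `u i` is adjacent to `v j` exactly when `(i, j)` is a cross edge. -/
def ladderRel (m n : ℕ) (cross : Finset (Fin m × Fin n)) :
    Fin m ⊕ Fin n → Fin m ⊕ Fin n → Prop
  | Sum.inl i, Sum.inl j => (i : ℕ) + 1 = (j : ℕ)
  | Sum.inr i, Sum.inr j => (i : ℕ) + 1 = (j : ℕ)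
  | Sum.inl i, Sum.inr j => (i, j) ∈ cross
  | Sum.inr _, Sum.inl _ => False

/-- The generalized (m,n)-ladder graph determined by the set `cross` of cross edges
`[G₁, G₂]`.  Vertices `Sum.inl i` are the vertices `u_{i+1}` of the path `G₁` and
vertices `Sum.inr j` are the vertices `v_{j+1}` of the path `G₂`. -/
def ladderGraph (m n : ℕ) (cross : Finset (Fin m × Fin n)) :
    SimpleGraph (Fin m ⊕ Fin n) :=
  SimpleGraph.fromRel (ladderRel m n cross)

/-- `L↑(e)`: the cross edges `e'` with `l(e) < l(e')`. -/
def Lup {m n : ℕ} (cross : Finset (Fin m × Fin n)) (e : Fin m × Fin n) :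
    Finset (Fin m × Fin n) := cross.filter fun e' => e.1 < e'.1

/-- `L↓(e)`: the cross edges `e'` with `l(e') < l(e)`. -/
def Ldown {m n : ℕ} (cross : Finset (Fin m × Fin n)) (e : Fin m × Fin n) :
    Finset (Fin m × Fin n) := cross.filter fun e' => e'.1 < e.1

/-- `R↑(e)`: the cross edges `e'` with `r(e) < r(e')`. -/
def Rup {m n : ℕ} (cross : Finset (Fin m × Fin n)) (e : Fin m × Fin n) :
    Finset (Fin m × Fin n) := cross.filter fun e' => e.2 < e'.2

/-- `R↓(e)`: the cross edges `e'` with `r(e') < r(e)`. -/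
def Rdown {m n : ℕ} (cross : Finset (Fin m × Fin n)) (e : Fin m × Fin n) :
    Finset (Fin m × Fin n) := cross.filter fun e' => e'.2 < e.2

/-- If cross edges `e`, `e'` both satisfy `L↑(·) ∩ R↓(·) = ∅`, then either
(`l(e) ≤ l(e')` and `r(e) ≤ r(e')`) or (`l(e') ≤ l(e)` and `r(e') ≤ r(e)`). -/
theorem ladder_X_comparable (m n : ℕ) (hm : 0 < m) (hn : 0 < n)
    (cross : Finset (Fin m × Fin n)) (e e' : Fin m × Fin n)
    (he : e ∈ cross) (he' : e' ∈ cross)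
    (h1 : Lup cross e ∩ Rdown cross e = ∅)
    (h2 : Lup cross e' ∩ Rdown cross e' = ∅) :
    (e.1 ≤ e'.1 ∧ e.2 ≤ e'.2) ∨ (e'.1 ≤ e.1 ∧ e'.2 ≤ e.2) := by
  have key : ∀ a b : Fin m × Fin n, b ∈ cross → Lup cross a ∩ Rdown cross a = ∅ →
      a.1 < b.1 → a.2 ≤ b.2 := by
    intro a b hb h hl
    by_contra! hr
    have hmem : b ∈ Lup cross a ∩ Rdown cross a := by simp [Lup, Rdown, hb, hl, hr]
    simp [h] at hmem
  rcases lt_trichotomy e.1 e'.1 with h | h | h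
  · exact Or.inl ⟨h.le, key e e' he' h1 h⟩
  · exact (le_total e.2 e'.2).imp (fun hr => ⟨h.le, hr⟩) (fun hr => ⟨h.ge, hr⟩)
  · exact Or.inr ⟨h.le, key e' e he h2 h⟩
end

section
/- Let G be a generalized (m,n)-ladder graph and let e, e' ∈ [G₁,G₂] be edges such that L↑(e) ∩ R↓(e) = ∅, L↑(e') ∩ R↑(e') = ∅, and L↑(e') ∩ R↓(e') ≠ ∅. Then r(e) ≤ r(e'). -/
open SimpleGraph

/-- If `e`, `e'` are cross edges with `L↑(e) ∩ R↓(e) = ∅`, `L↑(e') ∩ R↑(e') = ∅`, and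
`L↑(e') ∩ R↓(e') ≠ ∅`, then `r(e) ≤ r(e')`. -/
theorem ladder_XY_r_le (m n : ℕ) (hm : 0 < m) (hn : 0 < n)
    (cross : Finset (Fin m × Fin n)) (e e' : Fin m × Fin n)
    (he : e ∈ cross) (he' : e' ∈ cross)
    (h1 : Lup cross e ∩ Rdown cross e = ∅)
    (h2 : Lup cross e' ∩ Rup cross e' = ∅)
    (h3 : (Lup cross e' ∩ Rdown cross e').Nonempty) :
    e.2 ≤ e'.2 := by
  by_contra! hlt
  obtain ⟨f, hf⟩ := h3
  simp only [Lup, Rdown, Finset.mem_inter, Finset.mem_filter] at hf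
  obtain ⟨⟨hfc, hfl⟩, -, hfr⟩ := hf
  rcases lt_or_ge e'.1 e.1 with hl | hl
  · have : e ∈ Lup cross e' ∩ Rup cross e' := by simp [Lup, Rup, he, hl, hlt]
    simp [h2] at this
  · have : f ∈ Lup cross e ∩ Rdown cross e := by
      simp [Lup, Rdown, hfc, hl.trans_lt hfl, hfr.trans hlt]
    simp [h1] at this
end

section
/- Let G be a generalized (m,n)-ladder graph and let e, e' ∈ [G₁,G₂] be edges such that L↑(e) ∩ R↓(e) = ∅, L↓(e') ∩ R↓(e') = ∅, and L↑(e') ∩ R↓(e') ≠ ∅. Then l(e') ≤ l(e). -/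
open SimpleGraph

/-- If `e`, `e'` are cross edges with `L↑(e) ∩ R↓(e) = ∅`, `L↓(e') ∩ R↓(e') = ∅`, and
`L↑(e') ∩ R↓(e') ≠ ∅`, then `l(e') ≤ l(e)`. -/
theorem ladder_XW_l_le (m n : ℕ) (hm : 0 < m) (hn : 0 < n)
    (cross : Finset (Fin m × Fin n)) (e e' : Fin m × Fin n)
    (he : e ∈ cross) (he' : e' ∈ cross)
    (h1 : Lup cross e ∩ Rdown cross e = ∅)
    (h2 : Ldown cross e' ∩ Rdown cross e' = ∅)
    (h3 : (Lup cross e' ∩ Rdown cross e').Nonempty) :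
    e'.1 ≤ e.1 := by
  by_contra hlt
  rw [not_le] at hlt
  obtain ⟨f, hf⟩ := h3
  simp only [Lup, Rdown, Finset.mem_inter, Finset.mem_filter] at hf
  obtain ⟨⟨hfc, hfl⟩, -, hfr⟩ := hf
  have up_le : ∀ g ∈ cross, e.1 < g.1 → e.2 ≤ g.2 := fun g hg hl => by
    by_contra hr
    exact Finset.eq_empty_iff_forall_notMem.mp h1 g
      (by simp [Lup, Rdown, hg, hl, not_le.mp hr])
  have down_le : e'.2 ≤ e.2 := by
    by_contra hr
    exact Finset.eq_empty_iff_forall_notMem.mp h2 e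
      (by simp [Ldown, Rdown, he, hlt, not_le.mp hr])
  exact absurd (up_le f hfc (hlt.trans hfl)) (not_le.mpr (hfr.trans_le down_le))
end

section
/- Let G be a generalized (m,n)-ladder graph and let e, e' ∈ [G₁,G₂] be edges such that L↑(e) ∩ R↑(e) = ∅, L↓(e') ∩ R↑(e') = ∅, and L↑(e') ∩ R↑(e') ≠ ∅. Then l(e') ≤ l(e). -/
open SimpleGraph

/-- If `e`, `e'` are cross edges with `L↑(e) ∩ R↑(e) = ∅`, `L↓(e') ∩ R↑(e') = ∅`, and
`L↑(e') ∩ R↑(e') ≠ ∅`, then `l(e') ≤ l(e)`. -/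
theorem ladder_YZ_l_le (m n : ℕ) (hm : 0 < m) (hn : 0 < n)
    (cross : Finset (Fin m × Fin n)) (e e' : Fin m × Fin n)
    (he : e ∈ cross) (he' : e' ∈ cross)
    (h1 : Lup cross e ∩ Rup cross e = ∅)
    (h2 : Ldown cross e' ∩ Rup cross e' = ∅)
    (h3 : (Lup cross e' ∩ Rup cross e').Nonempty) :
    e'.1 ≤ e.1 := by
  obtain ⟨f, hf⟩ := h3
  rw [Finset.eq_empty_iff_forall_notMem] at h1 h2
  have h_up := h1 e'
  have h_up_f := h1 f
  have h_down := h2 e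
  simp only [Lup, Ldown, Rup, Finset.mem_inter, Finset.mem_filter] at hf h_up h_up_f h_down
  by_contra! hlt
  have h_le : e'.2 ≤ e.2 := not_lt.mp fun h => h_up ⟨⟨he', hlt⟩, he', h⟩
  have h_ge : e.2 ≤ e'.2 := not_lt.mp fun h => h_down ⟨⟨he, hlt⟩, he, h⟩
  have h_eq : e.2 = e'.2 := le_antisymm h_ge h_le
  exact h_up_f ⟨⟨hf.1.1, hlt.trans hf.1.2⟩, hf.1.1, h_eq ▸ hf.2.2⟩
end

section
/- Let G be a generalized (m,n)-ladder graph and let e, e' ∈ [G₁,G₂] be edges such that L↓(e) ∩ R↑(e) = ∅, L↓(e') ∩ R↓(e') = ∅, and L↓(e') ∩ R↑(e') ≠ ∅. Then r(e') ≤ r(e). -/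
open SimpleGraph

/-- If `e`, `e'` are cross edges with `L↓(e) ∩ R↑(e) = ∅`, `L↓(e') ∩ R↓(e') = ∅`, and
`L↓(e') ∩ R↑(e') ≠ ∅`, then `r(e') ≤ r(e)`. -/
theorem ladder_ZW_r_le (m n : ℕ) (hm : 0 < m) (hn : 0 < n)
    (cross : Finset (Fin m × Fin n)) (e e' : Fin m × Fin n)
    (he : e ∈ cross) (he' : e' ∈ cross)
    (h1 : Ldown cross e ∩ Rup cross e = ∅)
    (h2 : Ldown cross e' ∩ Rdown cross e' = ∅)
    (h3 : (Ldown cross e' ∩ Rup cross e').Nonempty) :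
    e'.2 ≤ e.2 := by
  by_contra! hlt
  obtain ⟨f, hf⟩ := h3
  simp only [Ldown, Rup, Finset.mem_inter, Finset.mem_filter] at hf
  obtain ⟨⟨hfc, hfl⟩, -, hfr⟩ := hf
  have hle : e'.1 ≤ e.1 := by
    by_contra! hl
    have hmem : e ∈ Ldown cross e' ∩ Rdown cross e' := by
      simp [Ldown, Rdown, he, hl, hlt]
    simp [h2] at hmem
  have hmem : f ∈ Ldown cross e ∩ Rup cross e := by
    simp [Ldown, Rup, hfc, hfl.trans_le hle, hlt.trans hfr]
  simp [h1] at hmem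
end

section
/- Let G be a generalized (m,n)-ladder graph. If G is outerplanar, then for every pair of edges e, f ∈ [G₁,G₂] the following holds: if L↑(e) ∩ R↑(e) ≠ ∅ or L↓(e) ∩ R↓(e) ≠ ∅, then L↑(f) ∩ R↓(f) = ∅ and L↓(f) ∩ R↑(f) = ∅. -/
open SimpleGraph

/-- `x` and `y` are joined by a walk of `G` that stays inside `S`. -/
def JoinedWithin {V : Type*} (G : SimpleGraph V) (x y : V) (S : Set V) : Prop :=
  ∃ w : G.Walk x y, ∀ v ∈ w.support, v ∈ S

namespace JoinedWithin

variable {V : Type*} {G : SimpleGraph V} {x y z : V} {S T : Set V}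

theorem symm (h : JoinedWithin G x y S) : JoinedWithin G y x S := by
  obtain ⟨w, hw⟩ := h
  exact ⟨w.reverse, by simpa using hw⟩

theorem trans (h : JoinedWithin G x y S) (h' : JoinedWithin G y z T) :
    JoinedWithin G x z (S ∪ T) := by
  obtain ⟨w, hw⟩ := h
  obtain ⟨w', hw'⟩ := h'
  refine ⟨w.append w', fun v hv => ?_⟩
  rw [SimpleGraph.Walk.mem_support_append_iff] at hv
  exact hv.imp (hw v) (hw' v)

theorem mono (h : JoinedWithin G x y S) (hST : S ⊆ T) : JoinedWithin G x y T := by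
  obtain ⟨w, hw⟩ := h
  exact ⟨w, fun v hv => hST (hw v hv)⟩

theorem of_adj (h : G.Adj x y) : JoinedWithin G x y {x, y} :=
  ⟨h.toWalk, by simp⟩

theorem of_line {m : ℕ} {a : Fin m → V}
    (ha : ∀ i j : Fin m, (i : ℕ) + 1 = j → G.Adj (a i) (a j)) (i j : Fin m) :
    JoinedWithin G (a i) (a j) (a '' Set.uIcc i j) := by
  have key : ∀ (d : ℕ) (i j : Fin m), (i : ℕ) + d = j →
      JoinedWithin G (a i) (a j) (a '' Set.Icc i j) := by
    intro d
    induction d with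
    | zero =>
      intro i j h
      obtain rfl : i = j := Fin.ext (by simpa using h)
      exact ⟨SimpleGraph.Walk.nil, by simp⟩
    | succ d ih =>
      intro i j h
      have hk : (i : ℕ) + d < m := by omega
      refine ((ih i ⟨i + d, hk⟩ rfl).trans (of_adj (ha ⟨i + d, hk⟩ j (by simp; omega)))).mono ?_
      rintro v (⟨k, hk', rfl⟩ | rfl | rfl)
      · exact ⟨k, by simp only [Set.mem_Icc, Fin.le_def] at hk' ⊢; omega, rfl⟩
      · exact ⟨_, by simp only [Set.mem_Icc, Fin.le_def]; omega, rfl⟩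
      · exact ⟨j, by simp only [Set.mem_Icc, Fin.le_def]; omega, rfl⟩
  rcases le_total i j with h | h
  · rw [Set.uIcc_of_le h]
    exact key (j - i) i j (by omega)
  · rw [Set.uIcc_of_ge h]
    exact (key (i - j) j i (by omega)).symm

end JoinedWithin

/-- To exhibit a subdivision it suffices to give, for every edge, a region in which the branch
vertices are joined, provided that distinct regions meet only in common branch vertices. -/
theorem containsSubdivision_of_joinedWithin {V W : Type*} {G : SimpleGraph V} {H : SimpleGraph W}
    (f : W → V) (hf : Function.Injective f) (S : W → W → Set V)
    (hS : ∀ a b, H.Adj a b → JoinedWithin G (f a) (f b) (S a b))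
    (hbranch : ∀ a b, H.Adj a b → ∀ w, f w ∈ S a b → w = a ∨ w = b)
    (hdisj : ∀ a b a' b', H.Adj a b → H.Adj a' b' → s(a, b) ≠ s(a', b') →
      ∀ v ∈ S a b, v ∈ S a' b' → v ∈ Set.range f) :
    ContainsSubdivision G H := by
  classical
  choose w hw using hS
  have hsub : ∀ a b h, ∀ v ∈ (w a b h).bypass.support, v ∈ S a b := fun a b h v hv =>
    hw a b h v ((w a b h).support_bypass_subset_support hv)
  refine ⟨f, hf, fun a b h => (w a b h).bypass, fun a b h => (w a b h).bypass_isPath,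
    fun a b h x hx => hbranch a b h x (hsub a b h _ hx), ?_⟩
  intro a b a' b' h h' hne v hv hv'
  obtain ⟨x, rfl⟩ := hdisj a b a' b' h h' hne v (hsub a b h v hv) (hsub a' b' h' v hv')
  exact ⟨(hbranch a b h x (hsub a b h _ hv)).imp (congrArg f) (congrArg f),
    (hbranch a' b' h' x (hsub a' b' h' _ hv')).imp (congrArg f) (congrArg f)⟩

section TwoLines

variable {V α β : Type*} [LinearOrder α] [LinearOrder β] {G : SimpleGraph V}
  {a : α → V} {b : β → V}

set_option maxHeartbeats 1000000 in
/-- Three cross edges `p`, `q`, `r` such that `p` separates `q` from `r` on the first line, while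
`q` separates `p` from `r` on the second line (`q` and `r` may share their end there), give a
subdivision of `K₃,₂` with poles `a p.1` and `b q.2`. -/
theorem containsSubdivision_K32_of_lines
    (ha : Function.Injective a) (hb : Function.Injective b) (hab : ∀ i j, a i ≠ b j)
    (hA : ∀ i j, JoinedWithin G (a i) (a j) (a '' Set.uIcc i j))
    (hB : ∀ i j, JoinedWithin G (b i) (b j) (b '' Set.uIcc i j))
    {p q r : α × β} (hp : G.Adj (a p.1) (b p.2)) (hq : G.Adj (a q.1) (b q.2))
    (hr : G.Adj (a r.1) (b r.2))
    (h₁ : q.1 < p.1 ∧ p.1 < r.1 ∨ r.1 < p.1 ∧ p.1 < q.1)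
    (h₂ : p.2 < q.2 ∧ q.2 ≤ r.2 ∨ r.2 ≤ q.2 ∧ q.2 < p.2) :
    ContainsSubdivision G (completeBipartiteGraph (Fin 3) (Fin 2)) := by
  obtain ⟨p1, p2⟩ := p
  obtain ⟨q1, q2⟩ := q
  obtain ⟨r1, r2⟩ := r
  simp only at *
  have hba : ∀ i j, b j ≠ a i := fun i j => (hab i j).symm
  let g : Fin 3 → V := ![a q1, b p2, a r1]
  let k : Fin 2 → V := ![a p1, b q2]
  let T : Fin 3 → Fin 2 → Set V :=
    ![![a '' Set.uIcc q1 p1, {a q1, b q2}],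
      ![{a p1, b p2}, b '' Set.uIcc p2 q2],
      ![a '' Set.uIcc r1 p1, {a r1, b r2} ∪ b '' Set.uIcc r2 q2]]
  have hT : ∀ i j, JoinedWithin G (g i) (k j) (T i j) := by
    intro i j
    fin_cases i <;> fin_cases j
    · exact hA _ _
    · exact .of_adj hq
    · exact (JoinedWithin.of_adj hp).symm
    · exact hB _ _
    · exact hA _ _
    · exact (JoinedWithin.of_adj hr).trans (hB _ _)
  have hgk : Function.Injective (Sum.elim g k) := by
    have h12 : q1 ≠ r1 := by grind
    have h13 : p1 ≠ q1 := by grind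
    have h14 : p1 ≠ r1 := by grind
    have h15 : p2 ≠ q2 := by grind
    rintro (i | i) (j | j) h <;> fin_cases i <;> fin_cases j <;>
      simp_all [g, k, ha.eq_iff, hb.eq_iff, eq_comm]
  have hgT : ∀ i j i', g i' ∈ T i j → i' = i := by
    intro i j i' h
    fin_cases i <;> fin_cases j <;> fin_cases i' <;>
      simp [g, T, Set.mem_uIcc, hab, hba, ha.eq_iff, hb.eq_iff] at h ⊢ <;> grind only
  have hkT : ∀ i j j', k j' ∈ T i j → j' = j := by
    intro i j j' h
    fin_cases i <;> fin_cases j <;> fin_cases j' <;>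
      simp [k, T, Set.mem_uIcc, hab, hba, ha.eq_iff, hb.eq_iff] at h ⊢ <;> grind only
  have hTT : ∀ i j i' j', (i ≠ i' ∨ j ≠ j') → ∀ v ∈ T i j, v ∈ T i' j' →
      v ∈ Set.range (Sum.elim g k) := by
    have interior : ∀ i j, ∀ v ∈ T i j, v ∉ Set.range (Sum.elim g k) →
        (i = 0 ∧ j = 0 ∧ ∃ x, a x = v ∧ x ∈ Set.uIcc q1 p1 ∧ x ≠ p1) ∨
        (i = 1 ∧ j = 1 ∧ ∃ y, b y = v ∧ y ∈ Set.uIcc p2 q2 ∧ y ≠ q2) ∨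
        (i = 2 ∧ j = 0 ∧ ∃ x, a x = v ∧ x ∈ Set.uIcc r1 p1 ∧ x ≠ p1) ∨
        (i = 2 ∧ j = 1 ∧ ∃ y, b y = v ∧ y ∈ Set.uIcc r2 q2 ∧ y ≠ q2) := by
      intro i j v hv hr
      have hf : ∀ z, Sum.elim g k z ≠ v := fun z hz => hr ⟨z, hz⟩
      have hf₀ := hf (.inl 0)
      have hf₁ := hf (.inl 1)
      have hf₂ := hf (.inl 2)
      have hf₃ := hf (.inr 0)
      have hf₄ := hf (.inr 1)
      have hr₂ : r2 ∈ Set.uIcc r2 q2 := Set.left_mem_uIcc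
      fin_cases i <;> fin_cases j <;> simp [g, k, T] at hv hf₀ hf₁ hf₂ hf₃ hf₄ ⊢ <;> grind only
    intro i j i' j' hne v hv hv'
    by_contra hr
    simp only [Set.mem_uIcc] at interior
    rcases interior i j v hv hr with h | h | h | h <;>
      rcases interior i' j' v hv' hr with h' | h' | h' | h' <;>
      grind [Function.Injective]
  refine containsSubdivision_of_joinedWithin (Sum.elim g k) hgk
    (fun x y => match x, y with
      | .inl i, .inr j => T i j
      | .inr j, .inl i => T i j
      | _, _ => ∅) ?_ ?_ ?_
  · rintro (i | i) (j | j) h <;> simp at h ⊢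
    · exact hT i j
    · exact (hT j i).symm
  · rintro (i | i) (j | j) h (l | l) hl <;> simp at h hl ⊢
    · exact hgT _ _ _ hl
    · exact hkT _ _ _ hl
    · exact hgT _ _ _ hl
    · exact hkT _ _ _ hl
  · rintro (i | i) (j | j) (i' | i') (j' | j') h h' hne v hv hv' <;>
      simp at h h' hne hv hv'
    all_goals exact hTT _ _ _ _ (by tauto) v hv hv'

/-- Two vertices on each line, with all four cross edges between them, give a subdivision of
`K₄`. -/
theorem containsSubdivision_K4_of_lines
    (ha : Function.Injective a) (hb : Function.Injective b) (hab : ∀ i j, a i ≠ b j)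
    (hA : ∀ i j, JoinedWithin G (a i) (a j) (a '' Set.uIcc i j))
    (hB : ∀ i j, JoinedWithin G (b i) (b j) (b '' Set.uIcc i j))
    {i i' : α} {j j' : β} (hi : i ≠ i') (hj : j ≠ j')
    (h₁ : G.Adj (a i) (b j)) (h₂ : G.Adj (a i) (b j'))
    (h₃ : G.Adj (a i') (b j)) (h₄ : G.Adj (a i') (b j')) :
    ContainsSubdivision G (completeGraph (Fin 4)) := by
  have hba : ∀ i j, b j ≠ a i := fun i j => (hab i j).symm
  let f : Fin 4 → V := ![a i, a i', b j, b j']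
  let T : Fin 4 → Fin 4 → Set V := fun x y =>
    if x < 2 ∧ y < 2 then a '' Set.uIcc i i' else
    if 2 ≤ x ∧ 2 ≤ y then b '' Set.uIcc j j' else {f x, f y}
  refine containsSubdivision_of_joinedWithin f ?_ T ?_ ?_ ?_
  · intro x y h
    fin_cases x <;> fin_cases y <;> simp [f, hab, hba, ha.eq_iff, hb.eq_iff] at h ⊢ <;> grind only
  · intro x y h
    fin_cases x <;> fin_cases y <;> simp [f, T] at h ⊢
    all_goals first
      | exact hA _ _
      | exact hB _ _
      | exact (hA _ _).symm.mono (by simp)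
      | exact (hB _ _).symm.mono (by simp)
      | exact .of_adj ‹_›
      | exact .of_adj (SimpleGraph.Adj.symm ‹_›)
  · intro x y h z hz
    fin_cases x <;> fin_cases y <;> fin_cases z <;>
      simp [f, T, hab, hba, ha.eq_iff, hb.eq_iff] at h hz ⊢ <;> grind only
  · intro x y x' y' h h' hne v hv hv'
    by_contra hr
    have interior : ∀ x y, x ≠ y → v ∈ T x y →
        s(x, y) = s(0, 1) ∧ v ∈ Set.range a ∨ s(x, y) = s(2, 3) ∧ v ∈ Set.range b := by
      have hf : ∀ z, f z ≠ v := fun z hz => hr ⟨z, hz⟩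
      have hf₀ := hf 0
      have hf₁ := hf 1
      have hf₂ := hf 2
      have hf₃ := hf 3
      intro x y hxy hv
      fin_cases x <;> fin_cases y <;> simp [f, T] at hxy hv hf₀ hf₁ hf₂ hf₃ ⊢ <;> grind only
    rcases interior x y h.ne hv with ⟨e, c, hc⟩ | ⟨e, c, hc⟩ <;>
      rcases interior x' y' h'.ne hv' with ⟨e', c', hc'⟩ | ⟨e', c', hc'⟩ <;> grind

end TwoLines

theorem ladderGraph_adj_inl {m n : ℕ} {cross : Finset (Fin m × Fin n)} (i j : Fin m)
    (h : (i : ℕ) + 1 = j) : (ladderGraph m n cross).Adj (Sum.inl i) (Sum.inl j) := by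
  simp only [ladderGraph, SimpleGraph.fromRel_adj, ladderRel, ne_eq, Sum.inl.injEq, Fin.ext_iff]
  omega

theorem ladderGraph_adj_inr {m n : ℕ} {cross : Finset (Fin m × Fin n)} (i j : Fin n)
    (h : (i : ℕ) + 1 = j) : (ladderGraph m n cross).Adj (Sum.inr i) (Sum.inr j) := by
  simp only [ladderGraph, SimpleGraph.fromRel_adj, ladderRel, ne_eq, Sum.inr.injEq, Fin.ext_iff]
  omega

theorem ladderGraph_adj_of_mem {m n : ℕ} {cross : Finset (Fin m × Fin n)} {e : Fin m × Fin n}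
    (h : e ∈ cross) : (ladderGraph m n cross).Adj (Sum.inl e.1) (Sum.inr e.2) := by
  simp [ladderGraph, ladderRel, h]

/-- In an outerplanar ladder graph no cross edge is parallel to one cross edge and crosses
another. -/
theorem not_parallel_and_crossing {m n : ℕ} {cross : Finset (Fin m × Fin n)}
    (hG : IsOuterplanar (ladderGraph m n cross)) {p q r : Fin m × Fin n}
    (hp : p ∈ cross) (hq : q ∈ cross) (hr : r ∈ cross)
    (hpq : p.1 < q.1 ∧ p.2 < q.2 ∨ q.1 < p.1 ∧ q.2 < p.2)
    (hpr : p.1 < r.1 ∧ r.2 < p.2 ∨ r.1 < p.1 ∧ p.2 < r.2) : False := by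
  have hA := JoinedWithin.of_line (ladderGraph_adj_inl (cross := cross))
  have hB := JoinedWithin.of_line (ladderGraph_adj_inr (cross := cross))
  have left : ∀ {q r}, q ∈ cross → r ∈ cross →
      (q.1 < p.1 ∧ p.1 < r.1 ∨ r.1 < p.1 ∧ p.1 < q.1) →
      (p.2 < q.2 ∧ q.2 ≤ r.2 ∨ r.2 ≤ q.2 ∧ q.2 < p.2) → False :=
    fun hq hr h₁ h₂ => hG.2 <| containsSubdivision_K32_of_lines Sum.inl_injective
      Sum.inr_injective (by simp) hA hB (ladderGraph_adj_of_mem hp) (ladderGraph_adj_of_mem hq)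
      (ladderGraph_adj_of_mem hr) h₁ h₂
  have right : ∀ {q r}, q ∈ cross → r ∈ cross →
      (q.2 < p.2 ∧ p.2 < r.2 ∨ r.2 < p.2 ∧ p.2 < q.2) →
      (p.1 < q.1 ∧ q.1 ≤ r.1 ∨ r.1 ≤ q.1 ∧ q.1 < p.1) → False :=
    fun {q r} hq hr h₁ h₂ => hG.2 <| containsSubdivision_K32_of_lines (p := p.swap) (q := q.swap)
      (r := r.swap) Sum.inr_injective Sum.inl_injective (by simp) hB hA
      (ladderGraph_adj_of_mem hp).symm (ladderGraph_adj_of_mem hq).symm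
      (ladderGraph_adj_of_mem hr).symm h₁ h₂
  rcases le_total q.1 r.1 with h₁ | h₁ <;> rcases le_total q.2 r.2 with h₂ | h₂ <;>
    rcases hpq with hpq | hpq <;> rcases hpr with hpr | hpr <;>
    first
    | omega
    | exact left hq hr (by omega) (by omega)
    | exact left hr hq (by omega) (by omega)
    | exact right hq hr (by omega) (by omega)
    | exact right hr hq (by omega) (by omega)

theorem not_exists_parallel_and_exists_crossing {m n : ℕ} {cross : Finset (Fin m × Fin n)}
    (hG : IsOuterplanar (ladderGraph m n cross)) {a b c d : Fin m × Fin n}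
    (ha : a ∈ cross) (hb : b ∈ cross) (hc : c ∈ cross) (hd : d ∈ cross)
    (hab₁ : a.1 < b.1) (hab₂ : a.2 < b.2) (hcd₁ : c.1 < d.1) (hcd₂ : d.2 < c.2) : False := by
  have h₁ : ¬ _ := fun h => not_parallel_and_crossing hG ha hb hc (by omega) h
  have h₂ : ¬ _ := fun h => not_parallel_and_crossing hG ha hb hd (by omega) h
  have h₃ : ¬ _ := fun h => not_parallel_and_crossing hG hb ha hc (by omega) h
  have h₄ : ¬ _ := fun h => not_parallel_and_crossing hG hb ha hd (by omega) h
  have h₅ : ¬ _ := fun h => not_parallel_and_crossing hG hc ha hd h (by omega)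
  have h₆ : ¬ _ := fun h => not_parallel_and_crossing hG hc hb hd h (by omega)
  have h₇ : ¬ _ := fun h => not_parallel_and_crossing hG hd ha hc h (by omega)
  have h₈ : ¬ _ := fun h => not_parallel_and_crossing hG hd hb hc h (by omega)
  have hc₁ : c.1 = a.1 := by omega
  have hc₂ : c.2 = b.2 := by omega
  have hd₁ : d.1 = b.1 := by omega
  have hd₂ : d.2 = a.2 := by omega
  have hac := ladderGraph_adj_of_mem hc
  have hbd := ladderGraph_adj_of_mem hd
  rw [hc₁, hc₂] at hac
  rw [hd₁, hd₂] at hbd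
  exact hG.1 <| containsSubdivision_K4_of_lines Sum.inl_injective Sum.inr_injective (by simp)
    (JoinedWithin.of_line ladderGraph_adj_inl) (JoinedWithin.of_line ladderGraph_adj_inr)
    hab₁.ne hab₂.ne (ladderGraph_adj_of_mem ha) hac hbd (ladderGraph_adj_of_mem hb)

/-- If a generalized ladder graph is outerplanar, then for every pair `e`, `f` of cross
edges: if `L↑(e) ∩ R↑(e) ≠ ∅` or `L↓(e) ∩ R↓(e) ≠ ∅`, then `L↑(f) ∩ R↓(f) = ∅` and
`L↓(f) ∩ R↑(f) = ∅`. -/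
theorem ladder_outerplanar_necessary (m n : ℕ) (hm : 0 < m) (hn : 0 < n)
    (cross : Finset (Fin m × Fin n))
    (hG : IsOuterplanar (ladderGraph m n cross)) :
    ∀ e ∈ cross, ∀ f ∈ cross,
      ((Lup cross e ∩ Rup cross e).Nonempty ∨ (Ldown cross e ∩ Rdown cross e).Nonempty) →
      Lup cross f ∩ Rdown cross f = ∅ ∧ Ldown cross f ∩ Rup cross f = ∅ := by
  intro e he f hf h
  obtain ⟨a, ha, b, hb, h₁, h₂⟩ :
      ∃ a ∈ cross, ∃ b ∈ cross, a.1 < b.1 ∧ a.2 < b.2 := by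
    rcases h with ⟨g, hg⟩ | ⟨g, hg⟩
    · simp only [Lup, Rup, Finset.mem_inter, Finset.mem_filter] at hg
      exact ⟨e, he, g, hg.1.1, hg.1.2, hg.2.2⟩
    · simp only [Ldown, Rdown, Finset.mem_inter, Finset.mem_filter] at hg
      exact ⟨g, hg.1.1, e, he, hg.1.2, hg.2.2⟩
  constructor <;> refine Finset.eq_empty_of_forall_notMem fun g hg => ?_
  · simp only [Lup, Rdown, Finset.mem_inter, Finset.mem_filter] at hg
    exact not_exists_parallel_and_exists_crossing hG ha hb hf hg.1.1 h₁ h₂ hg.1.2 hg.2.2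
  · simp only [Ldown, Rup, Finset.mem_inter, Finset.mem_filter] at hg
    exact not_exists_parallel_and_exists_crossing hG ha hb hg.1.1 hf h₁ h₂ hg.1.2 hg.2.2
end
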